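/- arXiv:math/0504153 — 6 statements merged into one kernel-verified Lean document; each statement's English description precedes it below -/
import Mathlib

section
/- For every n ≥ 0, the number of vicious (1,1)-stars of length n equals 2^n·binom(2n+2, n+1)/(n+2). -/
/-- A single directed walk of length `n`: consecutive ordinates differ by `±1`. -/
def IsSteps {n : ℕ} (w : Fin (n + 1) → ℤ) : Prop :=
  ∀ m : Fin n, w m.succ - w m.castSucc = 1 ∨ w m.succ - w m.castSucc = -1

/-- A configuration of three walkers is non-crossing if the ordinates stay ordered. -/
def NonCrossing {n : ℕ} (p : Fin 3 → Fin (n + 1) → ℤ) : Prop :=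
  ∀ m, p 0 m ≤ p 1 m ∧ p 1 m ≤ p 2 m

/-- An osculating configuration of three walkers: three `±1`-step walks, non-crossing,
and whenever two neighbouring walkers meet at time `m < n` they separate at time `m+1`. -/
def Osculating {n : ℕ} (p : Fin 3 → Fin (n + 1) → ℤ) : Prop :=
  (∀ k, IsSteps (p k)) ∧ NonCrossing p ∧
    ∀ m : Fin n,
      (p 0 m.castSucc = p 1 m.castSucc → p 0 m.succ < p 1 m.succ) ∧
      (p 1 m.castSucc = p 2 m.castSucc → p 1 m.succ < p 2 m.succ)

/-- A vicious (non-intersecting) configuration of three walkers. -/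
def Vicious {n : ℕ} (p : Fin 3 → Fin (n + 1) → ℤ) : Prop :=
  (∀ k, IsSteps (p k)) ∧ ∀ m, p 0 m < p 1 m ∧ p 1 m < p 2 m

/-- An `(i,j)`-star starts at ordinates `0`, `2i`, `2(i+j)`. -/
def Starts {n : ℕ} (i j : ℕ) (p : Fin 3 → Fin (n + 1) → ℤ) : Prop :=
  p 0 0 = 0 ∧ p 1 0 = 2 * (i : ℤ) ∧ p 2 0 = 2 * ((i : ℤ) + (j : ℤ))

/-- Vicious configurations of three walkers of length `n` starting at the ordinates `v`. -/
def ViciousFrom (n : ℕ) (v : Fin 3 → ℤ) : Type :=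
  {p : Fin 3 → Fin (n + 1) → ℤ // Vicious p ∧ ∀ k, p k 0 = v k}

/-- The position reached from `v` when walker `k` steps up if `e k` holds and down otherwise. -/
def stepFrom (v : Fin 3 → ℤ) (e : Fin 3 → Bool) : Fin 3 → ℤ :=
  fun k => v k + if e k then 1 else -1

/-- The directions of the first steps of a configuration. -/
def firstSteps {n : ℕ} {v : Fin 3 → ℤ} (p : ViciousFrom (n + 1) v) : Fin 3 → Bool :=
  fun k => decide (p.1 k 0 < p.1 k 1)

/-- Removing the first step of a configuration with prescribed first steps. -/
def firstStepsFiberEquiv (n : ℕ) {v : Fin 3 → ℤ} (h01 : v 0 < v 1) (h12 : v 1 < v 2)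
    (e : Fin 3 → Bool) :
    {p : ViciousFrom (n + 1) v // firstSteps p = e} ≃ ViciousFrom n (stepFrom v e) where
  toFun p := ⟨fun k m => p.1.1 k m.succ, by
    obtain ⟨⟨p, ⟨hs, ho⟩, hv⟩, rfl⟩ := p
    refine ⟨⟨fun k m => ?_, fun m => ho m.succ⟩, fun k => ?_⟩
    · simpa only [Fin.succ_castSucc] using hs k m.succ
    · have h := hs k 0
      simp only [Fin.succ_zero_eq_one, Fin.castSucc_zero] at h
      simp only [stepFrom, firstSteps, Fin.succ_zero_eq_one, decide_eq_true_eq, ← hv k]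
      split_ifs <;> omega⟩
  invFun q := ⟨⟨fun k => Fin.cons (v k) (q.1 k), by
    obtain ⟨q, ⟨hs, ho⟩, hv⟩ := q
    refine ⟨⟨fun k m => ?_, fun m => ?_⟩, fun k => rfl⟩
    · refine Fin.cases ?_ (fun m => ?_) m
      · simp only [Fin.cons_succ, Fin.castSucc_zero, Fin.cons_zero, hv k, stepFrom]
        split_ifs <;> omega
      · simpa only [← Fin.succ_castSucc, Fin.cons_succ] using hs k m
    · refine Fin.cases ?_ (fun m => ?_) m
      · exact ⟨h01, h12⟩
      · exact ho m⟩, by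
    funext k
    have h := q.2.2 k
    simp only [firstSteps, ← Fin.succ_zero_eq_one, Fin.cons_zero, Fin.cons_succ, h, stepFrom]
    cases e k <;> simp⟩
  left_inv p := by
    refine Subtype.ext (Subtype.ext (funext fun k => funext fun m => ?_))
    refine Fin.cases ?_ (fun m => ?_) m
    · exact (p.1.2.2 k).symm
    · rfl
  right_inv q := rfl

theorem isEmpty_viciousFrom (n : ℕ) {v : Fin 3 → ℤ} (h : ¬(v 0 < v 1 ∧ v 1 < v 2)) :
    IsEmpty (ViciousFrom n v) :=
  ⟨fun p => h (by simpa only [p.2.2] using p.2.1.2 0)⟩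

theorem subsingleton_viciousFrom_zero (v : Fin 3 → ℤ) : Subsingleton (ViciousFrom 0 v) :=
  ⟨fun p q => Subtype.ext <| funext fun k => funext fun m => by
    rw [Fin.fin_one_eq_zero m]
    exact (p.2.2 k).trans (q.2.2 k).symm⟩

theorem finite_viciousFrom (n : ℕ) (v : Fin 3 → ℤ) : Finite (ViciousFrom n v) := by
  induction n generalizing v with
  | zero =>
    have := subsingleton_viciousFrom_zero v
    infer_instance
  | succ n ih =>
    by_cases h : v 0 < v 1 ∧ v 1 < v 2
    · have (e : Fin 3 → Bool) := Finite.of_equiv _ (firstStepsFiberEquiv n h.1 h.2 e).symm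
      exact Finite.of_equiv _ (Equiv.sigmaFiberEquiv (firstSteps (n := n) (v := v)))
    · have := isEmpty_viciousFrom (n + 1) h
      infer_instance

theorem card_viciousFrom_succ (n : ℕ) {v : Fin 3 → ℤ} (h01 : v 0 < v 1) (h12 : v 1 < v 2) :
    Nat.card (ViciousFrom (n + 1) v) =
      ∑ e : Fin 3 → Bool, Nat.card (ViciousFrom n (stepFrom v e)) := by
  have := finite_viciousFrom (n + 1) v
  rw [← Nat.card_congr (Equiv.sigmaFiberEquiv (firstSteps (n := n) (v := v))), Nat.card_sigma]
  exact Finset.sum_congr rfl fun e _ => Nat.card_congr (firstStepsFiberEquiv n h01 h12 e)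

theorem card_viciousFrom_zero {v : Fin 3 → ℤ} (h01 : v 0 < v 1) (h12 : v 1 < v 2) :
    Nat.card (ViciousFrom 0 v) = 1 := by
  exact Nat.card_eq_one_iff_unique.mpr ⟨subsingleton_viciousFrom_zero v,
    ⟨⟨fun k _ => v k, ⟨fun _ m => m.elim0, fun _ => ⟨h01, h12⟩⟩, fun _ => rfl⟩⟩⟩

/-- The number of vicious pairs of walks of length `n` starting at distance `2 * d`. -/
def pairCount (n d : ℕ) : ℤ :=
  ∑ k ∈ Finset.range d, ((2 * n + 1).choose (n + 1 + k) : ℤ)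

theorem pairCount_zero_right (n : ℕ) : pairCount n 0 = 0 := rfl

theorem pairCount_succ_right (n d : ℕ) :
    pairCount n (d + 1) = pairCount n d + (2 * n + 1).choose (n + 1 + d) :=
  Finset.sum_range_succ _ _

theorem pairCount_zero_left (d : ℕ) : pairCount 0 (d + 1) = 1 := by
  induction d with
  | zero => simp [pairCount]
  | succ d ih => rw [pairCount_succ_right, ih, Nat.choose_eq_zero_of_lt (by omega)]; simp

theorem pairCount_succ_left (n d : ℕ) :
    pairCount (n + 1) (d + 1) = pairCount n d + 2 * pairCount n (d + 1) + pairCount n (d + 2) := by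
  have pascal (k : ℕ) : (2 * (n + 1) + 1).choose (k + 2) =
      (2 * n + 1).choose k + 2 * (2 * n + 1).choose (k + 1) + (2 * n + 1).choose (k + 2) := by
    rw [show 2 * (n + 1) + 1 = 2 * n + 1 + 1 + 1 by ring]
    simp only [Nat.choose_succ_succ' (_ + 1), Nat.choose_succ_succ' (2 * n)]
    ring
  induction d with
  | zero =>
    have h := pascal n
    have hs := Nat.choose_symm_half n
    simp only [pairCount_succ_right, pairCount_zero_right, add_zero]
    rw [show n + 1 + 1 = n + 2 by ring, h, ← hs]
    push_cast
    ring
  | succ d ih =>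
    have h := pascal (n + 1 + d)
    rw [pairCount_succ_right (n + 1), ih, pairCount_succ_right n (d + 2),
      pairCount_succ_right n (d + 1), pairCount_succ_right n d,
      show n + 1 + 1 + (d + 1) = n + 1 + d + 2 by ring, h]
    push_cast [add_assoc]
    ring

theorem card_viciousFrom (n x y : ℕ) {v : Fin 3 → ℤ} (h01 : v 1 = v 0 + 2 * x)
    (h12 : v 2 = v 1 + 2 * y) :
    (Nat.card (ViciousFrom n v) : ℤ) =
      2 ^ n * (pairCount n x + pairCount n y - pairCount n (x + y)) := by
  induction n generalizing x y v with
  | zero =>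
    rcases x with _ | x
    · have := isEmpty_viciousFrom 0 (v := v) (by omega)
      simp [pairCount_zero_right]
    rcases y with _ | y
    · have := isEmpty_viciousFrom 0 (v := v) (by omega)
      simp [pairCount_zero_right]
    rw [card_viciousFrom_zero (by omega) (by omega), ← add_assoc]
    simp only [pairCount_zero_left]
    norm_num
  | succ n ih =>
    rcases x with _ | x
    · have := isEmpty_viciousFrom (n + 1) (v := v) (by omega)
      simp [pairCount_zero_right]
    rcases y with _ | y
    · have := isEmpty_viciousFrom (n + 1) (v := v) (by omega)
      simp [pairCount_zero_right]
    have univ_eq : (Finset.univ : Finset (Fin 3 → Bool)) =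
        {![true, true, true], ![true, true, false], ![true, false, true], ![true, false, false],
          ![false, true, true], ![false, true, false], ![false, false, true],
          ![false, false, false]} := by decide
    rw [card_viciousFrom_succ n (by omega) (by omega), univ_eq]
    repeat rw [Finset.sum_insert (by decide)]
    rw [Finset.sum_singleton]
    push_cast at h01 h12 ⊢
    rw [ih (x + 1) (y + 1), ih (x + 1) y, ih x (y + 2), ih x (y + 1), ih (x + 2) (y + 1),
      ih (x + 2) y, ih (x + 1) (y + 2), ih (x + 1) (y + 1)]
    · rw [show x + 1 + (y + 1) = x + y + 1 + 1 by ring, pairCount_succ_left, pairCount_succ_left,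
        pairCount_succ_left]
      ring_nf
    all_goals
      simp [stepFrom]
      omega

theorem vicious_one_one_star_count (n : ℕ) :
    (Nat.card {p : Fin 3 → Fin (n + 1) → ℤ // Vicious p ∧ Starts 1 1 p} : ℚ) =
      2 ^ n * (Nat.choose (2 * n + 2) (n + 1) : ℚ) / (n + 2) := by
  have hcard : Nat.card {p : Fin 3 → Fin (n + 1) → ℤ // Vicious p ∧ Starts 1 1 p} =
      Nat.card (ViciousFrom n ![0, 2, 4]) := by
    refine Nat.card_congr (Equiv.subtypeEquivRight fun p => ?_)
    simp [Starts, Fin.forall_fin_succ]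
  have h := card_viciousFrom n 1 1 (v := ![0, 2, 4]) (by simp) (by simp)
  have hsub : (n + 2) * (2 * n + 1).choose (n + 2) = n * (2 * n + 1).choose (n + 1) := by
    have := Nat.choose_succ_right_eq (2 * n + 1) (n + 1)
    rw [show 2 * n + 1 - (n + 1) = n by omega] at this
    linarith
  have hdouble : (2 * n + 2).choose (n + 1) = 2 * (2 * n + 1).choose (n + 1) := by
    rw [Nat.choose_succ_succ' (2 * n + 1), Nat.choose_symm_half]
    ring
  simp only [pairCount_succ_right, pairCount_zero_right] at h
  rw [hcard, hdouble, eq_div_iff (by positivity)]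
  qify at h hsub
  rw [h]
  push_cast [add_assoc] at hsub ⊢
  linear_combination -(2 : ℚ) ^ n * hsub
end

section
/- For all integers i, j, k, ℓ ≥ 1, n ≥ 0 and 0 ≤ r ≤ n, the number of vicious (i,j)-stars of length n whose three paths end respectively at ordinates −n+2r, −n+2r+2k, and −n+2r+2k+2ℓ equals the 3×3 determinant det [[C(n,r), C(n,r+k), C(n,r+k+ℓ)], [C(n,r−i), C(n,r+k−i), C(n,r+k+ℓ−i)], [C(n,r−i−j), C(n,r+k−i−j), C(n,r+k+ℓ−i−j)]], where C(n,m) denotes the binomial coefficient, with C(n,m)=0 whenever m<0 or m>n. -/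
/-- The binomial coefficient `C(n,m)` for an integer `m`, equal to `0` when `m < 0`
(and, via `Nat.choose`, when `m > n`). -/
def ch (n : ℕ) (m : ℤ) : ℤ := if 0 ≤ m then (n.choose m.toNat : ℤ) else 0

/-- The vicious configurations of `N` walkers of length `n` with prescribed start and end points. -/
def viciousPaths {N : ℕ} (n : ℕ) (x y : Fin N → ℤ) : Set (Fin N → Fin (n + 1) → ℤ) :=
  {p | (∀ k, IsSteps (p k)) ∧ (∀ m, StrictMono fun k => p k m) ∧
    (∀ k, p k 0 = x k) ∧ ∀ k, p k (Fin.last n) = y k}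

/-- Positions after one step in which exactly the walkers in `T` go up. -/
def stepUp {N : ℕ} (x : Fin N → ℤ) (T : Finset (Fin N)) : Fin N → ℤ :=
  T.piecewise (fun k => x k + 1) fun k => x k - 1

/-- The matrix whose `(i, j)` entry counts the `n`-step walks from `s i` to `e j`
in which every step adds `0` or `1`. -/
def walkMatrix {N : ℕ} (n : ℕ) (s e : Fin N → ℤ) : Matrix (Fin N) (Fin N) ℤ :=
  Matrix.of fun i j => ch n (e j - s i)

lemma ch_zero (m : ℤ) : ch 0 m = if m = 0 then 1 else 0 := by
  unfold ch
  split_ifs with h1 h2 h2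
  · simp [h2]
  · obtain ⟨a, rfl⟩ := Int.eq_ofNat_of_zero_le h1
    have : a ≠ 0 := by simpa using h2
    simp [Nat.choose_eq_zero_of_lt (Nat.pos_of_ne_zero this)]
  · omega
  · rfl

lemma ch_succ (n : ℕ) (m : ℤ) : ch (n + 1) m = ch n (m - 1) + ch n m := by
  rcases lt_trichotomy m 0 with h | rfl | h
  · simp [ch, show ¬ 0 ≤ m by omega, show ¬ 1 ≤ m by omega]
  · simp [ch]
  · obtain ⟨a, rfl⟩ : ∃ a : ℕ, m = a + 1 := ⟨(m - 1).toNat, by omega⟩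
    simp [ch, show (0 : ℤ) ≤ a + 1 by omega, show ((a : ℤ) + 1).toNat = a + 1 by omega,
      Nat.choose_succ_succ]

lemma det_walkMatrix_succ {N : ℕ} (n : ℕ) (s e : Fin N → ℤ) :
    (walkMatrix (n + 1) s e).det =
      ∑ T : Finset (Fin N), (walkMatrix n (T.piecewise (fun k => s k + 1) s) e).det := by
  have h : walkMatrix (n + 1) s e =
      (walkMatrix n (fun k => s k + 1) e : Fin N → Fin N → ℤ) + walkMatrix n s e := by
    ext i j
    simp [walkMatrix, ch_succ, sub_sub]
  have h2 := (Matrix.detRowAlternating (R := ℤ) (n := Fin N)).toMultilinearMap.map_add_univ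
    (walkMatrix n (fun k => s k + 1) e) (walkMatrix n s e)
  rw [h]
  refine h2.trans (Finset.sum_congr rfl fun T _ => ?_)
  refine congrArg Matrix.det ?_
  ext i j
  by_cases hi : i ∈ T <;> simp [walkMatrix, Finset.piecewise, hi]

lemma det_walkMatrix_zero {N : ℕ} {s e : Fin N → ℤ} (hs : StrictMono s) (he : StrictMono e) :
    (walkMatrix 0 s e).det = if s = e then 1 else 0 := by
  split_ifs with h
  · subst h
    rw [← Matrix.det_one (n := Fin N)]
    congr 1
    ext i j
    simp [walkMatrix, ch_zero, Matrix.one_apply, sub_eq_zero, hs.injective.eq_iff, eq_comm]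
  · by_contra hdet
    rw [Matrix.det_apply] at hdet
    obtain ⟨σ, -, hσ⟩ := Finset.exists_ne_zero_of_sum_ne_zero hdet
    have hprod : ∀ i, e i = s (σ i) := by
      intro i
      by_contra hne
      refine hσ ?_
      rw [Finset.prod_eq_zero (Finset.mem_univ i), smul_zero]
      simp [walkMatrix, ch_zero, sub_eq_zero, hne]
    refine h ((hs.range_inj he).1 ?_)
    rw [show e = s ∘ σ from funext hprod, σ.surjective.range_comp]

lemma det_walkMatrix_eq_zero {N : ℕ} (n : ℕ) {s : Fin N → ℤ} (e : Fin N → ℤ)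
    (hs : ¬ Function.Injective s) : (walkMatrix n s e).det = 0 := by
  simp only [Function.Injective, not_forall] at hs
  obtain ⟨a, b, hab, hne⟩ := hs
  exact Matrix.det_zero_of_row_eq hne (by ext j; simp [walkMatrix, hab])

lemma monotone_piecewise_add_one {N : ℕ} {s : Fin N → ℤ} (hs : StrictMono s)
    (T : Finset (Fin N)) : Monotone (T.piecewise (fun k => s k + 1) s) := by
  intro a b hab
  rcases hab.eq_or_lt with rfl | hlt
  · rfl
  · have := hs hlt
    simp only [Finset.piecewise]
    split_ifs <;> omega

lemma cons_mem_viciousPaths {N n : ℕ} {x y : Fin N → ℤ} (hx : StrictMono x)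
    {T : Finset (Fin N)} {q : Fin N → Fin (n + 1) → ℤ} (hq : q ∈ viciousPaths n (stepUp x T) y) :
    (fun k => Fin.cons (x k) (q k) : Fin N → Fin (n + 2) → ℤ) ∈ viciousPaths (n + 1) x y := by
  obtain ⟨h1, h2, h3, h4⟩ := hq
  refine ⟨fun k m => ?_, fun m => ?_, fun k => rfl, fun k => ?_⟩
  · refine Fin.cases ?_ (fun m => ?_) m
    · simp only [Fin.cons_succ, Fin.castSucc_zero, Fin.cons_zero, h3, stepUp]
      by_cases hk : k ∈ T <;> simp [hk]
    · simpa only [Fin.cons_succ, Fin.castSucc_succ] using h1 k m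
  · refine Fin.cases ?_ (fun m => ?_) m
    · simpa using hx
    · simpa using h2 m
  · simpa only [← Fin.succ_last, Fin.cons_succ] using h4 k

/-- Splitting a vicious configuration according to its first step. -/
noncomputable def viciousPathsSuccEquiv {N : ℕ} (n : ℕ) {x : Fin N → ℤ} (y : Fin N → ℤ)
    (hx : StrictMono x) :
    (Σ T : Finset (Fin N), viciousPaths n (stepUp x T) y) ≃ viciousPaths (n + 1) x y :=
  Equiv.ofBijective (fun q => ⟨_, cons_mem_viciousPaths hx q.2.2⟩) <| by
    constructor
    · rintro ⟨T, q, hq⟩ ⟨T', q', hq'⟩ h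
      have hqq : q = q' := by
        ext k m
        have := congrFun (congrFun (congrArg Subtype.val h) k) m.succ
        simpa using this
      subst hqq
      have hT : T = T' := by
        ext k
        have h1 := (hq.2.2.1 k).symm.trans (hq'.2.2.1 k)
        by_cases hk : k ∈ T <;> by_cases hk' : k ∈ T' <;> simp [stepUp, hk, hk'] at h1 ⊢
        all_goals omega
      subst hT
      rfl
    · rintro ⟨p, h1, h2, h3, h4⟩
      refine ⟨⟨Finset.univ.filter fun k => p k 1 = x k + 1, fun k => Fin.tail (p k),
        fun k m => h1 k m.succ, fun m => h2 m.succ, fun k => ?_, fun k => h4 k⟩, ?_⟩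
      · have h := h1 k 0
        simp only [Fin.castSucc_zero, h3, Fin.succ_zero_eq_one] at h
        by_cases hk : p k 1 = x k + 1
        · simp [stepUp, Fin.tail, hk]
        · simp [stepUp, Fin.tail, hk]
          omega
      · apply Subtype.ext
        funext k
        simp only [← h3 k, Fin.cons_self_tail]

lemma viciousPaths_eq_empty {N n : ℕ} {x y : Fin N → ℤ} (hx : ¬ StrictMono x) :
    viciousPaths n x y = ∅ := by
  refine Set.eq_empty_of_forall_notMem fun p hp => hx ?_
  simpa only [hp.2.2.1] using hp.2.1 0

lemma viciousPaths_zero {N : ℕ} {x y : Fin N → ℤ} (hx : StrictMono x) :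
    viciousPaths 0 x y = if x = y then {fun k _ => x k} else ∅ := by
  ext p
  split_ifs with h
  · subst h
    simp only [Set.mem_singleton_iff]
    constructor
    · intro hp
      ext k m
      rw [Fin.fin_one_eq_zero m, hp.2.2.1]
    · rintro rfl
      exact ⟨fun k m => m.elim0, fun _ => hx, fun _ => rfl, fun _ => rfl⟩
  · refine ⟨fun hp => h (funext fun k => ?_), fun hp => hp.elim⟩
    rw [← hp.2.2.1, ← hp.2.2.2]
    rfl

/-- **Lindström–Gessel–Viennot** for vicious walkers starting at ordinates of equal parity. -/
theorem card_viciousPaths {N : ℕ} {e : Fin N → ℤ} (he : StrictMono e) (c : ℤ) (n : ℕ)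
    (s : Fin N → ℤ) (hs : Monotone s) :
    Finite (viciousPaths n (fun k => 2 * s k + c + n) fun k => 2 * e k + c) ∧
      (Nat.card (viciousPaths n (fun k => 2 * s k + c + n) fun k => 2 * e k + c) : ℤ) =
        (walkMatrix n s e).det := by
  induction n generalizing s with
  | zero =>
    by_cases hinj : Function.Injective s
    · have hs' := hs.strictMono_of_injective hinj
      have hx : StrictMono fun k => 2 * s k + c + (0 : ℕ) := fun a b hab => by
        have := hs' hab
        dsimp only
        omega
      have hiff : ((fun k => 2 * s k + c + (0 : ℕ)) = fun k => 2 * e k + c) ↔ s = e := by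
        simp [funext_iff]
      rw [viciousPaths_zero hx, det_walkMatrix_zero hs' he]
      simp only [hiff]
      split_ifs
      · exact ⟨Set.finite_singleton _, by simp⟩
      · exact ⟨Set.finite_empty, by simp⟩
    · rw [det_walkMatrix_eq_zero 0 e hinj, viciousPaths_eq_empty]
      · exact ⟨Set.finite_empty, by simp⟩
      · exact fun h => hinj fun a b hab => h.injective (by simp [hab])
  | succ n ih =>
    by_cases hinj : Function.Injective s
    · have hs' := hs.strictMono_of_injective hinj
      have hx : StrictMono fun k => 2 * s k + c + (n + 1 : ℕ) := fun a b hab => by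
        have := hs' hab
        dsimp only
        omega
      have hstep (T : Finset (Fin N)) : stepUp (fun k => 2 * s k + c + (n + 1 : ℕ)) T =
          fun k => 2 * T.piecewise (fun k => s k + 1) s k + c + n := by
        ext k
        by_cases hk : k ∈ T <;> simp [stepUp, hk] <;> ring
      have E := viciousPathsSuccEquiv n (fun k => 2 * e k + c) hx
      simp only [hstep] at E
      have ih' (T : Finset (Fin N)) := ih _ (monotone_piecewise_add_one hs' T)
      have (T : Finset (Fin N)) := (ih' T).1
      refine ⟨Finite.of_equiv _ E, ?_⟩
      rw [← Nat.card_congr E, Nat.card_sigma, det_walkMatrix_succ]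
      push_cast
      exact Finset.sum_congr rfl fun T _ => (ih' T).2
    · rw [det_walkMatrix_eq_zero _ e hinj, viciousPaths_eq_empty]
      · exact ⟨Set.finite_empty, by simp⟩
      · exact fun h => hinj fun a b hab => h.injective (by simp [hab])

lemma strictMono_fin_three {f : Fin 3 → ℤ} : StrictMono f ↔ f 0 < f 1 ∧ f 1 < f 2 := by
  rw [Fin.strictMono_iff_lt_succ, Fin.forall_fin_two]
  rfl

theorem vicious_star_count_det (i j k l : ℕ) (hi : 1 ≤ i) (hj : 1 ≤ j)
    (hk : 1 ≤ k) (hl : 1 ≤ l) (n r : ℕ) (hr : r ≤ n) :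
    (Nat.card {p : Fin 3 → Fin (n + 1) → ℤ // Vicious p ∧ Starts i j p ∧
        p 0 (Fin.last n) = -(n : ℤ) + 2 * r ∧
        p 1 (Fin.last n) = -(n : ℤ) + 2 * r + 2 * k ∧
        p 2 (Fin.last n) = -(n : ℤ) + 2 * r + 2 * k + 2 * l} : ℤ) =
      Matrix.det
        !![ch n (r : ℤ), ch n ((r : ℤ) + k), ch n ((r : ℤ) + k + l);
           ch n ((r : ℤ) - i), ch n ((r : ℤ) + k - i), ch n ((r : ℤ) + k + l - i);
           ch n ((r : ℤ) - i - j), ch n ((r : ℤ) + k - i - j),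
             ch n ((r : ℤ) + k + l - i - j)] := by
  have he : StrictMono ![(r : ℤ), r + k, r + k + l] := by
    rw [strictMono_fin_three]
    simp
    omega
  have hs : StrictMono ![(0 : ℤ), i, i + j] := by
    rw [strictMono_fin_three]
    simp
    omega
  have hdet : walkMatrix n ![(0 : ℤ), i, i + j] ![(r : ℤ), r + k, r + k + l] =
      !![ch n (r : ℤ), ch n ((r : ℤ) + k), ch n ((r : ℤ) + k + l);
           ch n ((r : ℤ) - i), ch n ((r : ℤ) + k - i), ch n ((r : ℤ) + k + l - i);
           ch n ((r : ℤ) - i - j), ch n ((r : ℤ) + k - i - j),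
             ch n ((r : ℤ) + k + l - i - j)] := by
    ext a b
    fin_cases a <;> fin_cases b <;> simp [walkMatrix, sub_sub]
  rw [← hdet, ← (card_viciousPaths he (-n) n _ hs.monotone).2]
  congr 1
  refine Nat.card_congr (Equiv.subtypeEquivRight fun p => ?_)
  simp only [Vicious, Starts, viciousPaths, Set.mem_ofPred_eq, strictMono_fin_three,
    Fin.forall_fin_succ (n := 2), Fin.forall_fin_two]
  simp
  constructor <;> (intro h; refine ⟨?_, ?_⟩ <;> grind)
end

section
/- For every n ≥ 0, the number of vicious (1,1)-stars of length n whose endpoints satisfy j_{n,2}−j_{n,1}=2 and j_{n,3}−j_{n,2}=2 (vicious watermelons) equals b_{n+1} = (2/((n+1)(n+2)^2)) · Σ_{r=0}^{n} C(n+2,r)·C(n+2,r+1)·C(n+2,r+2), the (n+1)-st Baxter number. -/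
/-- Vicious `(1,1)`-stars of length `n` with `a`, `b - 1`, `c - 2` up-steps respectively. -/
abbrev StarsTo (n : ℕ) (a b c : ℤ) : Type :=
  {p : Fin 3 → Fin (n + 1) → ℤ // Vicious p ∧ Starts 1 1 p ∧
    p 0 (Fin.last n) = 2 * a - n ∧ p 1 (Fin.last n) = 2 * b - n ∧ p 2 (Fin.last n) = 2 * c - n}

/-- The binomial coefficient with integer lower index, extended by zero. -/
def intChoose (m : ℕ) (y : ℤ) : ℚ := if 0 ≤ y then (m.choose y.toNat : ℚ) else 0

theorem intChoose_natCast (m k : ℕ) : intChoose m (k : ℤ) = m.choose k := by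
  simp [intChoose]

theorem intChoose_of_neg (m : ℕ) {y : ℤ} (hy : y < 0) : intChoose m y = 0 :=
  if_neg (not_le.mpr hy)

theorem add_one_mul_intChoose_sub_one (m : ℕ) (y : ℤ) :
    ((m : ℚ) + 1) * intChoose m (y - 1) = y * intChoose (m + 1) y := by
  rcases lt_or_ge y 0 with hy | hy
  · rw [intChoose_of_neg _ hy, intChoose_of_neg _ (by lia)]
    simp
  · lift y to ℕ using hy
    rcases y with _ | k
    · rw [intChoose_of_neg _ (by simp)]
      simp
    · have h := Nat.add_one_mul_choose_eq m k
      rw [show ((k + 1 : ℕ) : ℤ) - 1 = (k : ℤ) by simp, intChoose_natCast, intChoose_natCast]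
      push_cast
      rw [mul_comm ((k : ℚ) + 1)]
      exact_mod_cast h

theorem add_one_mul_intChoose (m : ℕ) (y : ℤ) :
    ((m : ℚ) + 1) * intChoose m y = (m + 1 - y) * intChoose (m + 1) y := by
  have pascal : intChoose (m + 1) y = intChoose m (y - 1) + intChoose m y := by
    rcases lt_or_ge y 0 with hy | hy
    · rw [intChoose_of_neg _ hy, intChoose_of_neg _ hy, intChoose_of_neg _ (by lia)]
      simp
    · lift y to ℕ using hy
      rcases y with _ | k
      · rw [intChoose_of_neg m (by simp : ((0 : ℕ) : ℤ) - 1 < 0), intChoose_natCast,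
          intChoose_natCast]
        simp
      · rw [show ((k + 1 : ℕ) : ℤ) - 1 = (k : ℤ) by simp, intChoose_natCast, intChoose_natCast,
          intChoose_natCast, Nat.choose_succ_succ, Nat.cast_add]
  linear_combination ((m : ℚ) + 1) * (-pascal) - add_one_mul_intChoose_sub_one m y

theorem StarsTo.snoc_mem {n : ℕ} {a b c : ℤ} (hab : a < b) (hbc : b < c) (e f g : Fin 2)
    (p : StarsTo n (a - (e : ℕ)) (b - (f : ℕ)) (c - (g : ℕ))) :
    Vicious (fun k => Fin.snoc (p.1 k) (2 * ![a, b, c] k - ((n + 1 : ℕ) : ℤ)) :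
        Fin 3 → Fin (n + 2) → ℤ) ∧
      Starts 1 1 (fun k => Fin.snoc (p.1 k) (2 * ![a, b, c] k - ((n + 1 : ℕ) : ℤ)) :
        Fin 3 → Fin (n + 2) → ℤ) := by
  obtain ⟨p, ⟨hs, hv⟩, hst, h0, h1, h2⟩ := p
  refine ⟨⟨fun k m => ?_, fun m => ?_⟩, ?_⟩
  · induction m using Fin.lastCases with
    | last =>
      simp only [Fin.succ_last, Fin.snoc_last, Fin.snoc_castSucc]
      have := e.isLt
      have := f.isLt
      have := g.isLt
      fin_cases k <;> simp <;> omega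
    | cast m =>
      simp only [Fin.succ_castSucc, Fin.snoc_castSucc]
      exact hs k m
  · induction m using Fin.lastCases with
    | last => simp; lia
    | cast m => simpa only [Fin.snoc_castSucc] using hv m
  · simpa only [Starts, ← Fin.castSucc_zero, Fin.snoc_castSucc] using hst

/-- Append a final step to a star. -/
def StarsTo.snoc {n : ℕ} {a b c : ℤ} (hab : a < b) (hbc : b < c)
    (x : Σ e : Fin 2 × Fin 2 × Fin 2,
      StarsTo n (a - (e.1 : ℕ)) (b - (e.2.1 : ℕ)) (c - (e.2.2 : ℕ))) :
    StarsTo (n + 1) a b c :=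
  ⟨fun k => Fin.snoc (x.2.1 k) (2 * ![a, b, c] k - ((n + 1 : ℕ) : ℤ)),
    (StarsTo.snoc_mem hab hbc _ _ _ x.2).1, (StarsTo.snoc_mem hab hbc _ _ _ x.2).2, by simp⟩

theorem StarsTo.snoc_injective {n : ℕ} {a b c : ℤ} (hab : a < b) (hbc : b < c) :
    Function.Injective (StarsTo.snoc (n := n) hab hbc) := by
  rintro ⟨⟨e, f, g⟩, p, hp⟩ ⟨⟨e', f', g'⟩, q, hq⟩ h
  have hpq : p = q := by
    funext k m
    have := congrFun (congrFun (congrArg Subtype.val h) k) m.castSucc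
    simpa only [StarsTo.snoc, Fin.snoc_castSucc] using this
  subst hpq
  obtain ⟨-, -, h0, h1, h2⟩ := hp
  obtain ⟨-, -, h0', h1', h2'⟩ := hq
  obtain rfl : e = e' := by apply Fin.ext; simp only at *; lia
  obtain rfl : f = f' := by apply Fin.ext; simp only at *; lia
  obtain rfl : g = g' := by apply Fin.ext; simp only at *; lia
  rfl

theorem StarsTo.snoc_surjective {n : ℕ} {a b c : ℤ} (hab : a < b) (hbc : b < c) :
    Function.Surjective (StarsTo.snoc (n := n) hab hbc) := by
  rintro ⟨p, ⟨hs, hv⟩, hst, h0, h1, h2⟩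
  have step : ∀ k y, p k (Fin.last (n + 1)) = 2 * y - ((n + 1 : ℕ) : ℤ) →
      ∃ e : Fin 2, p k (Fin.last n).castSucc = 2 * (y - ((e : ℕ) : ℤ)) - n := by
    intro k y hy
    have := hs k (Fin.last n)
    rw [Fin.succ_last, hy] at this
    rcases this with h | h
    · exact ⟨1, by push_cast at *; simp; lia⟩
    · exact ⟨0, by push_cast at *; simp; lia⟩
  obtain ⟨e, he⟩ := step 0 a h0
  obtain ⟨f, hf⟩ := step 1 b h1
  obtain ⟨g, hg⟩ := step 2 c h2
  refine ⟨⟨(e, f, g), fun k m => p k m.castSucc, ⟨fun k m => ?_, fun m => hv _⟩, ?_, he, hf, hg⟩,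
    Subtype.ext ?_⟩
  · simpa only [Fin.succ_castSucc] using hs k m.castSucc
  · simpa only [Starts, Fin.castSucc_zero] using hst
  · funext k m
    induction m using Fin.lastCases with
    | last => fin_cases k <;> simp [StarsTo.snoc, h0, h1, h2]
    | cast m => simp only [StarsTo.snoc, Fin.snoc_castSucc]

theorem StarsTo.isEmpty {n : ℕ} {a b c : ℤ} (h : ¬(a < b ∧ b < c)) : IsEmpty (StarsTo n a b c) := by
  refine ⟨fun ⟨p, ⟨_, hv⟩, _, h0, h1, h2⟩ => h ?_⟩
  have := hv (Fin.last n)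
  lia

instance StarsTo.subsingleton_zero (a b c : ℤ) : Subsingleton (StarsTo 0 a b c) := by
  refine ⟨fun ⟨p, _, _, h0, h1, h2⟩ ⟨q, _, _, h0', h1', h2'⟩ => Subtype.ext ?_⟩
  funext k m
  obtain rfl : m = Fin.last 0 := Fin.eq_zero m
  fin_cases k
  · exact h0.trans h0'.symm
  · exact h1.trans h1'.symm
  · exact h2.trans h2'.symm

instance StarsTo.finite (n : ℕ) (a b c : ℤ) : Finite (StarsTo n a b c) := by
  induction n generalizing a b c with
  | zero =>
    infer_instance
  | succ n ih =>
    by_cases h : a < b ∧ b < c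
    · exact Finite.of_surjective _ (StarsTo.snoc_surjective h.1 h.2)
    · have := StarsTo.isEmpty (n := n + 1) h
      infer_instance

theorem StarsTo.card_zero {a b c : ℤ} (hab : a < b) (hbc : b < c) :
    (4 : ℚ) * Nat.card (StarsTo 0 a b c) =
      (b - a) * (c - a) * (c - b) * (intChoose 2 a * intChoose 2 b * intChoose 2 c) := by
  by_cases h : a = 0 ∧ b = 1 ∧ c = 2
  · obtain ⟨rfl, rfl, rfl⟩ := h
    have : Nat.card (StarsTo 0 0 1 2) = 1 := by
      rw [Nat.card_eq_one_iff_unique]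
      refine ⟨inferInstance,
        ⟨fun k _ => 2 * (k : ℕ), ⟨fun _ m => m.elim0, ?_⟩, ?_⟩⟩
      · simp
      · simp [Starts]
    rw [this]
    have h0 := intChoose_natCast 2 0
    have h1 := intChoose_natCast 2 1
    have h2 := intChoose_natCast 2 2
    push_cast at h0 h1 h2
    rw [h0, h1, h2]
    norm_num
  · have : IsEmpty (StarsTo 0 a b c) := by
      refine ⟨fun ⟨p, _, ⟨h0, h1, h2⟩, h0', h1', h2'⟩ => h ?_⟩
      rw [show Fin.last 0 = 0 from rfl] at *
      push_cast at *
      lia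
    rw [Nat.card_of_isEmpty]
    have key : a < 0 ∨ 2 < c := by lia
    rcases key with h | h
    · simp [intChoose_of_neg _ h]
    · have : intChoose 2 c = 0 := by
        rw [intChoose, if_pos (by lia), Nat.choose_eq_zero_of_lt (by lia), Nat.cast_zero]
      simp [this]

theorem StarsTo.card_of_not_lt {n : ℕ} {a b c : ℤ} (h : ¬(a < b ∧ b < c)) :
    Nat.card (StarsTo n a b c) = 0 := by
  have := StarsTo.isEmpty (n := n) h
  exact Nat.card_of_isEmpty

theorem StarsTo.card {n : ℕ} {a b c : ℤ} (hab : a ≤ b) (hbc : b ≤ c) :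
    (((n : ℚ) + 1) * (n + 2) ^ 2) * Nat.card (StarsTo n a b c) =
      (b - a) * (c - a) * (c - b) *
        (intChoose (n + 2) a * intChoose (n + 2) b * intChoose (n + 2) c) := by
  by_cases hlt : a < b ∧ b < c
  swap
  · rw [StarsTo.card_of_not_lt hlt]
    rcases (by lia : a = b ∨ b = c) with rfl | rfl <;> simp
  induction n generalizing a b c with
  | zero =>
    have := StarsTo.card_zero hlt.1 hlt.2
    norm_num at this ⊢
    exact this
  | succ n ih =>
    have ih' : ∀ e f g : Fin 2,
        (((n : ℚ) + 1) * (n + 2) ^ 2) *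
            Nat.card (StarsTo n (a - (e : ℕ)) (b - (f : ℕ)) (c - (g : ℕ))) =
          ((b - (f : ℕ) : ℤ) - (a - (e : ℕ) : ℤ)) * ((c - (g : ℕ) : ℤ) - (a - (e : ℕ) : ℤ)) *
            ((c - (g : ℕ) : ℤ) - (b - (f : ℕ) : ℤ)) *
            (intChoose (n + 2) (a - (e : ℕ)) * intChoose (n + 2) (b - (f : ℕ)) *
              intChoose (n + 2) (c - (g : ℕ))) := by
      intro e f g
      have := e.isLt
      have := f.isLt
      have := g.isLt
      by_cases h : a - ((e : ℕ) : ℤ) < b - (f : ℕ) ∧ b - ((f : ℕ) : ℤ) < c - (g : ℕ)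
      · exact ih (by omega) (by omega) h
      · rw [StarsTo.card_of_not_lt h]
        rcases (by omega : a - ((e : ℕ) : ℤ) = b - (f : ℕ) ∨ b - ((f : ℕ) : ℤ) = c - (g : ℕ))
          with h | h <;> rw [h] <;> simp
    obtain ⟨hab, hbc⟩ := hlt
    have hcard := Nat.card_eq_of_bijective _
      ⟨StarsTo.snoc_injective (n := n) hab hbc, StarsTo.snoc_surjective hab hbc⟩
    rw [Nat.card_sigma] at hcard
    rw [← hcard, Nat.cast_sum]
    have hne : (((n : ℚ) + 1) * (n + 2) ^ 2) * (n + 3) ^ 3 ≠ 0 := by positivity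
    apply mul_left_cancel₀ hne
    have pull : ∀ K S : ℚ, (((n : ℚ) + 1) * (n + 2) ^ 2) * (n + 3) ^ 3 * (K * S) =
        K * (n + 3) ^ 3 * ((((n : ℚ) + 1) * (n + 2) ^ 2) * S) := by intros; ring
    rw [pull, Finset.mul_sum, Finset.sum_congr rfl (fun e _ => ih' e.1 e.2.1 e.2.2)]
    simp only [Fintype.sum_prod_type, Fin.sum_univ_two]
    have down : ∀ y : ℤ, intChoose (n + 2) (y - 1) =
        y * intChoose (n + 3) y / (n + 3) := by
      intro y
      have := add_one_mul_intChoose_sub_one (n + 2) y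
      rw [eq_div_iff (by positivity)]
      push_cast at this
      linear_combination this
    have stay : ∀ y : ℤ, intChoose (n + 2) y =
        (n + 3 - y) * intChoose (n + 3) y / (n + 3) := by
      intro y
      have := add_one_mul_intChoose (n + 2) y
      rw [eq_div_iff (by positivity)]
      push_cast at this
      linear_combination this
    simp only [Fin.val_zero, Fin.val_one, Nat.cast_zero, Nat.cast_one, sub_zero, down]
    rw [stay a, stay b, stay c]
    rw [show n + 1 + 2 = n + 3 from rfl]
    push_cast
    field_simp
    ring

theorem IsSteps.exists_last_eq {n : ℕ} {w : Fin (n + 1) → ℤ} (hw : IsSteps w) :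
    ∃ r : Fin (n + 1), w (Fin.last n) = w 0 + 2 * ((r : ℕ) : ℤ) - n := by
  induction n with
  | zero => exact ⟨0, by simp⟩
  | succ n ih =>
    obtain ⟨r, hr⟩ := ih (w := fun m => w m.castSucc) (fun m => by
      simpa only [Fin.succ_castSucc] using hw m.castSucc)
    have h := hw (Fin.last n)
    rw [Fin.succ_last] at h
    rw [Fin.castSucc_zero] at hr
    rcases h with h | h
    · exact ⟨r.succ, by push_cast [Fin.val_succ]; lia⟩
    · exact ⟨r.castSucc, by push_cast [Fin.val_castSucc]; lia⟩

/-- View a star with equispaced endpoints as a watermelon. -/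
def StarsTo.toWatermelon {n : ℕ}
    (x : Σ r : Fin (n + 1), StarsTo n (r : ℕ) ((r + 1 : ℕ) : ℤ) ((r + 2 : ℕ) : ℤ)) :
    {p : Fin 3 → Fin (n + 1) → ℤ // Vicious p ∧ Starts 1 1 p ∧
        p 1 (Fin.last n) - p 0 (Fin.last n) = 2 ∧
        p 2 (Fin.last n) - p 1 (Fin.last n) = 2} :=
  ⟨x.2.1, x.2.2.1, x.2.2.2.1, by
    obtain ⟨r, p, _, _, h0, h1, h2⟩ := x
    simp only at *
    lia⟩

theorem StarsTo.toWatermelon_bijective (n : ℕ) :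
    Function.Bijective (StarsTo.toWatermelon (n := n)) := by
  constructor
  · rintro ⟨r, p, hp⟩ ⟨s, q, hq⟩ h
    obtain rfl : p = q := congrArg Subtype.val h
    obtain rfl : r = s := by
      apply Fin.ext
      have := hp.2.2.1
      have := hq.2.2.1
      lia
    rfl
  · rintro ⟨p, hv, hst, h1, h2⟩
    obtain ⟨r, hr⟩ := (hv.1 0).exists_last_eq
    rw [hst.1] at hr
    exact ⟨⟨r, p, hv, hst, by lia, by lia, by lia⟩, rfl⟩

theorem vicious_watermelon_count (n : ℕ) :
    (Nat.card {p : Fin 3 → Fin (n + 1) → ℤ // Vicious p ∧ Starts 1 1 p ∧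
        p 1 (Fin.last n) - p 0 (Fin.last n) = 2 ∧
        p 2 (Fin.last n) - p 1 (Fin.last n) = 2} : ℚ) =
      2 / (((n : ℚ) + 1) * ((n : ℚ) + 2) ^ 2) *
        ∑ r ∈ Finset.range (n + 1),
          ((n + 2).choose r * (n + 2).choose (r + 1) * (n + 2).choose (r + 2) : ℚ) := by
  rw [← Nat.card_eq_of_bijective _ (StarsTo.toWatermelon_bijective n), Nat.card_sigma,
    ← Fin.sum_univ_eq_sum_range
      (fun r => ((n + 2).choose r * (n + 2).choose (r + 1) * (n + 2).choose (r + 2) : ℚ)),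
    Nat.cast_sum, Finset.mul_sum]
  refine Finset.sum_congr rfl fun r _ => ?_
  have h := StarsTo.card (n := n) (a := (r : ℕ)) (b := ((r + 1 : ℕ) : ℤ)) (c := ((r + 2 : ℕ) : ℤ))
    (by lia) (by lia)
  simp only [intChoose_natCast] at h
  push_cast at h ⊢
  rw [div_mul_eq_mul_div, eq_div_iff (by positivity)]
  linear_combination h
end

section
/- The complete generating functions of osculating (0,1)-stars and vicious (1,1)-stars satisfy, as an identity in ℚ[[t]][x,y] after clearing the denominator xy: (1+t)·xy·O_{0,1}(t;x,y) = xy^2 + t·(x+y+xy)·V_{1,1}(t;x,y). -/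
/-- The number of osculating `(i,j)`-stars of length `n` with
`j_{n,2} - j_{n,1} = 2k` and `j_{n,3} - j_{n,2} = 2l`. -/
noncomputable def oscCount (i j n k l : ℕ) : ℕ :=
  Nat.card {p : Fin 3 → Fin (n + 1) → ℤ // Osculating p ∧ Starts i j p ∧
    p 1 (Fin.last n) - p 0 (Fin.last n) = 2 * (k : ℤ) ∧
    p 2 (Fin.last n) - p 1 (Fin.last n) = 2 * (l : ℤ)}

/-- The number of vicious `(i,j)`-stars of length `n` with
`j_{n,2} - j_{n,1} = 2k` and `j_{n,3} - j_{n,2} = 2l`. -/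
noncomputable def vicCount (i j n k l : ℕ) : ℕ :=
  Nat.card {p : Fin 3 → Fin (n + 1) → ℤ // Vicious p ∧ Starts i j p ∧
    p 1 (Fin.last n) - p 0 (Fin.last n) = 2 * (k : ℤ) ∧
    p 2 (Fin.last n) - p 1 (Fin.last n) = 2 * (l : ℤ)}

/-- The complete generating function of osculating `(i,j)`-stars, as a multivariate
power series in `t = X 0`, `x = X 1`, `y = X 2`. -/
noncomputable def Ocgf (i j : ℕ) : MvPowerSeries (Fin 3) ℚ :=
  fun e => (oscCount i j (e 0) (e 1) (e 2) : ℚ)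

/-- The complete generating function of vicious `(i,j)`-stars, as a multivariate
power series in `t = X 0`, `x = X 1`, `y = X 2`. -/
noncomputable def Vcgf (i j : ℕ) : MvPowerSeries (Fin 3) ℚ :=
  fun e => (vicCount i j (e 0) (e 1) (e 2) : ℚ)

/-- Three `±1` walks, started at `0`, `2i`, `2(i+j)` and ending with gaps `2a` and `2b`, all of whose
gaps satisfy `G` and all of whose consecutive gaps are related by `R`. -/
def GapWalks (G : ℤ → Prop) (R : ℤ → ℤ → Prop) (i j n : ℕ) (a b : ℤ) :
    Set (Fin 3 → Fin (n + 1) → ℤ) :=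
  {p | (∀ k, IsSteps (p k)) ∧ (∀ m, G (p 1 m - p 0 m) ∧ G (p 2 m - p 1 m)) ∧
    (∀ m : Fin n, R (p 1 m.castSucc - p 0 m.castSucc) (p 1 m.succ - p 0 m.succ) ∧
      R (p 2 m.castSucc - p 1 m.castSucc) (p 2 m.succ - p 1 m.succ)) ∧
    Starts i j p ∧ p 1 (Fin.last n) - p 0 (Fin.last n) = 2 * a ∧
    p 2 (Fin.last n) - p 1 (Fin.last n) = 2 * b}

/-- A single step: `1` for `true` and `-1` for `false`. -/
def boolStep (s : Bool) : ℤ := if s then 1 else -1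

/-- Half of the difference of two steps. -/
def gapStep (s u : Bool) : ℤ := (if u then 1 else 0) - if s then 1 else 0

lemma boolStep_sub (s u : Bool) : boolStep u - boolStep s = 2 * gapStep s u := by
  cases s <;> cases u <;> rfl

lemma boolStep_decide {z : ℤ} (h : z = 1 ∨ z = -1) : boolStep (decide (z = 1)) = z := by
  rcases h with rfl | rfl <;> rfl

lemma isSteps_succ {n : ℕ} (w : Fin (n + 2) → ℤ) :
    IsSteps w ↔ IsSteps (Fin.init w) ∧
      (w (Fin.last (n + 1)) - w (Fin.last n).castSucc = 1 ∨
        w (Fin.last (n + 1)) - w (Fin.last n).castSucc = -1) := by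
  simp only [IsSteps, Fin.forall_fin_succ', Fin.init, Fin.succ_castSucc, Fin.succ_last]

/-- Membership in `GapWalks` after one more step, in terms of the walks without that step. -/
lemma mem_gapWalks_succ {G : ℤ → Prop} {R : ℤ → ℤ → Prop} {i j n : ℕ} {a b : ℤ}
    (p : Fin 3 → Fin (n + 2) → ℤ) (s : Fin 3 → Bool)
    (hs : ∀ k, p k (Fin.last (n + 1)) = p k (Fin.last n).castSucc + boolStep (s k)) :
    p ∈ GapWalks G R i j (n + 1) a b ↔
      (fun k => Fin.init (p k)) ∈
          GapWalks G R i j n (a - gapStep (s 0) (s 1)) (b - gapStep (s 1) (s 2)) ∧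
        G (2 * a) ∧ G (2 * b) ∧ R (2 * (a - gapStep (s 0) (s 1))) (2 * a) ∧
        R (2 * (b - gapStep (s 1) (s 2))) (2 * b) := by
  have h01 := boolStep_sub (s 0) (s 1)
  have h12 := boolStep_sub (s 1) (s 2)
  have e : ∀ k, (p k (Fin.last (n + 1)) - p k (Fin.last n).castSucc = 1 ∨
        p k (Fin.last (n + 1)) - p k (Fin.last n).castSucc = -1) := by
    intro k
    rw [hs k]
    cases s k <;> simp [boolStep]
  have ha : p 1 (Fin.last (n + 1)) - p 0 (Fin.last (n + 1)) = 2 * a ↔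
      p 1 (Fin.last n).castSucc - p 0 (Fin.last n).castSucc
        = 2 * (a - gapStep (s 0) (s 1)) := by
    rw [hs 0, hs 1]; constructor <;> intro h <;> linarith
  have hb : p 2 (Fin.last (n + 1)) - p 1 (Fin.last (n + 1)) = 2 * b ↔
      p 2 (Fin.last n).castSucc - p 1 (Fin.last n).castSucc
        = 2 * (b - gapStep (s 1) (s 2)) := by
    rw [hs 1, hs 2]; constructor <;> intro h <;> linarith
  have key : ∀ q : Fin 3 → Fin (n + 2) → ℤ, Starts i j q ↔
      Starts i j (fun k => Fin.init (q k)) := fun q => Iff.rfl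
  simp only [GapWalks, Set.mem_ofPred_eq, isSteps_succ, e, and_true, ← key]
  rw [Fin.forall_fin_succ' (P := fun m => G (p 1 m - p 0 m) ∧ G (p 2 m - p 1 m)),
    Fin.forall_fin_succ' (P := fun m : Fin (n + 1) =>
      R (p 1 m.castSucc - p 0 m.castSucc) (p 1 m.succ - p 0 m.succ) ∧
      R (p 2 m.castSucc - p 1 m.castSucc) (p 2 m.succ - p 1 m.succ))]
  simp only [Fin.succ_castSucc, Fin.succ_last, Nat.succ_eq_add_one]
  constructor
  · rintro ⟨h1, ⟨h2, h3, h4⟩, ⟨h5, h6, h7⟩, h8, h9, h10⟩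
    have h9' := ha.1 h9
    have h10' := hb.1 h10
    rw [h9] at h3 h6
    rw [h10] at h4 h7
    rw [h9'] at h6
    rw [h10'] at h7
    exact ⟨⟨h1, h2, h5, h8, h9', h10'⟩, h3, h4, h6, h7⟩
  · rintro ⟨⟨h1, h2, h5, h8, h9', h10'⟩, h3, h4, h6, h7⟩
    have h9 := ha.2 h9'
    have h10 := hb.2 h10'
    rw [← h9] at h3 h6
    rw [← h10] at h4 h7
    rw [← h9'] at h6
    rw [← h10'] at h7
    exact ⟨h1, ⟨h2, h3, h4⟩, ⟨h5, h6, h7⟩, h8, h9, h10⟩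

/-- The last steps of three walks, as Booleans. -/
def lastSteps {n : ℕ} (p : Fin 3 → Fin (n + 2) → ℤ) (k : Fin 3) : Bool :=
  decide (p k (Fin.last (n + 1)) - p k (Fin.last n).castSucc = 1)

lemma last_eq_add_lastSteps {G : ℤ → Prop} {R : ℤ → ℤ → Prop} {i j n : ℕ} {a b : ℤ}
    {p : Fin 3 → Fin (n + 2) → ℤ} (hp : p ∈ GapWalks G R i j (n + 1) a b) (k : Fin 3) :
    p k (Fin.last (n + 1)) = p k (Fin.last n).castSucc + boolStep (lastSteps p k) := by
  rw [lastSteps, boolStep_decide ((isSteps_succ _).1 (hp.1 k)).2]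
  ring

lemma lastSteps_snoc {n : ℕ} (c : Fin 3 → Fin (n + 1) → ℤ) (s : Fin 3 → Bool) :
    lastSteps (fun k => Fin.snoc (α := fun _ => ℤ) (c k) (c k (Fin.last n) + boolStep (s k))) =
      s := by
  funext k
  cases hk : s k <;> simp [lastSteps, boolStep, hk]

/-- Removing the last step, when that step is prescribed. -/
def gapWalksInitEquiv (G : ℤ → Prop) (R : ℤ → ℤ → Prop) (i j n : ℕ) (a b : ℤ)
    (s : Fin 3 → Bool) :
    {p : GapWalks G R i j (n + 1) a b // lastSteps p.1 = s} ≃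
      {_c : GapWalks G R i j n (a - gapStep (s 0) (s 1)) (b - gapStep (s 1) (s 2)) //
        G (2 * a) ∧ G (2 * b) ∧ R (2 * (a - gapStep (s 0) (s 1))) (2 * a) ∧
        R (2 * (b - gapStep (s 1) (s 2))) (2 * b)} where
  toFun p :=
    have h := (mem_gapWalks_succ p.1.1 s
      (fun k => (last_eq_add_lastSteps p.1.2 k).trans (by rw [p.2]))).1 p.1.2
    ⟨⟨fun k => Fin.init (p.1.1 k), h.1⟩, h.2⟩
  invFun c := ⟨⟨fun k => Fin.snoc (c.1.1 k) (c.1.1 k (Fin.last n) + boolStep (s k)),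
    (mem_gapWalks_succ _ s (fun k => by simp)).2 ⟨by simp, c.2⟩⟩,
    lastSteps_snoc _ _⟩
  left_inv := by
    rintro ⟨⟨p, hp⟩, rfl⟩
    refine Subtype.ext (Subtype.ext (funext fun k => ?_))
    dsimp only
    have h : Fin.init (p k) (Fin.last n) + boolStep (lastSteps p k) = p k (Fin.last (n + 1)) :=
      (last_eq_add_lastSteps hp k).symm
    rw [h, Fin.snoc_init_self]
  right_inv c := by
    refine Subtype.ext (Subtype.ext (funext fun k => ?_))
    simp

instance gapWalks_finite (G : ℤ → Prop) (R : ℤ → ℤ → Prop) (i j n : ℕ) (a b : ℤ) :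
    Finite (GapWalks G R i j n a b) := by
  induction n generalizing a b with
  | zero =>
    refine Set.Finite.subset (Set.finite_singleton
      (fun k _ => ![0, 2 * (i : ℤ), 2 * ((i : ℤ) + (j : ℤ))] k)) ?_
    rintro p ⟨-, -, -, ⟨h0, h1, h2⟩, -⟩
    simp only [Set.mem_singleton_iff]
    funext k m
    obtain rfl : m = 0 := Subsingleton.elim (α := Fin 1) m 0
    fin_cases k <;> simp [h0, h1, h2]
  | succ n ih =>
    have (s : Fin 3 → Bool) : Finite {p : GapWalks G R i j (n + 1) a b // lastSteps p.1 = s} :=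
      Finite.of_equiv _ (gapWalksInitEquiv G R i j n a b s).symm
    exact Finite.of_equiv _ (Equiv.sigmaFiberEquiv
      fun p : GapWalks G R i j (n + 1) a b => lastSteps p.1)

lemma card_gapWalks_succ (G : ℤ → Prop) (R : ℤ → ℤ → Prop) [DecidablePred G]
    [∀ u v, Decidable (R u v)] (i j n : ℕ) (a b : ℤ) :
    Nat.card (GapWalks G R i j (n + 1) a b) = ∑ s : Fin 3 → Bool,
      if G (2 * a) ∧ G (2 * b) ∧ R (2 * (a - gapStep (s 0) (s 1))) (2 * a) ∧
        R (2 * (b - gapStep (s 1) (s 2))) (2 * b)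
      then Nat.card (GapWalks G R i j n (a - gapStep (s 0) (s 1)) (b - gapStep (s 1) (s 2)))
      else 0 := by
  rw [← Nat.card_congr (Equiv.sigmaFiberEquiv
    fun p : GapWalks G R i j (n + 1) a b => lastSteps p.1), Nat.card_sigma]
  refine Finset.sum_congr rfl fun s _ => ?_
  rw [Nat.card_congr (gapWalksInitEquiv G R i j n a b s)]
  split_ifs with h
  · exact Nat.card_congr (Equiv.subtypeUnivEquiv fun _ => h)
  · have : IsEmpty {_c : GapWalks G R i j n (a - gapStep (s 0) (s 1)) (b - gapStep (s 1) (s 2)) //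
        G (2 * a) ∧ G (2 * b) ∧ R (2 * (a - gapStep (s 0) (s 1))) (2 * a) ∧
        R (2 * (b - gapStep (s 1) (s 2))) (2 * b)} := ⟨fun c => h c.2⟩
    exact Nat.card_of_isEmpty

lemma card_gapWalks_zero {G : ℤ → Prop} (R : ℤ → ℤ → Prop) {i j : ℕ} (hi : G (2 * i))
    (hj : G (2 * j)) (a b : ℤ) :
    Nat.card (GapWalks G R i j 0 a b) = if a = i ∧ b = j then 1 else 0 := by
  split_ifs with h
  · obtain ⟨rfl, rfl⟩ := h
    rw [Nat.card_eq_one_iff_unique]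
    constructor
    · refine ⟨fun p q => Subtype.ext (funext fun k => funext fun m => ?_)⟩
      obtain ⟨p, -, -, -, ⟨h0, h1, h2⟩, -⟩ := p
      obtain ⟨q, -, -, -, ⟨h0', h1', h2'⟩, -⟩ := q
      obtain rfl : m = 0 := Subsingleton.elim (α := Fin 1) m 0
      fin_cases k <;> simp [h0, h1, h2, h0', h1', h2']
    · refine ⟨⟨fun k _ => ![0, 2 * (i : ℤ), 2 * ((i : ℤ) + (j : ℤ))] k, fun _ m => m.elim0,
        fun _ => ?_, fun m => m.elim0, ⟨rfl, rfl, rfl⟩, ?_, ?_⟩⟩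
      · simpa [mul_add] using ⟨hi, hj⟩
      · simp
      · simp [mul_add]
  · have : IsEmpty (GapWalks G R i j 0 a b) := by
      refine ⟨?_⟩
      rintro ⟨p, -, -, -, ⟨h0, h1, h2⟩, h3, h4⟩
      simp only [Fin.last_zero, h0, h1, h2] at h3 h4
      omega
    exact Nat.card_of_isEmpty

/-- The number of osculating stars with integer-indexed final gaps. -/
noncomputable def oscNum (i j n : ℕ) (a b : ℤ) : ℕ :=
  Nat.card (GapWalks (0 ≤ ·) (fun u v => u = 0 → 0 < v) i j n a b)

/-- The number of vicious stars with integer-indexed final gaps. -/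
noncomputable def vicNum (i j n : ℕ) (a b : ℤ) : ℕ :=
  Nat.card (GapWalks (0 < ·) (fun _ _ => True) i j n a b)

lemma oscCount_eq (i j n k l : ℕ) : oscCount i j n k l = oscNum i j n k l := by
  refine Nat.card_congr (Equiv.subtypeEquivRight fun p => ?_)
  simp only [GapWalks, Osculating, NonCrossing, sub_nonneg, sub_pos, sub_eq_zero, and_assoc]
  simp only [eq_comm]
  rfl

lemma vicCount_eq (i j n k l : ℕ) : vicCount i j n k l = vicNum i j n k l := by
  refine Nat.card_congr (Equiv.subtypeEquivRight fun p => ?_)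
  simp only [GapWalks, Vicious, sub_pos, and_assoc, and_true, implies_true, true_and]
  rfl

lemma oscNum_zero (i j : ℕ) (a b : ℤ) :
    oscNum i j 0 a b = if a = i ∧ b = j then 1 else 0 :=
  card_gapWalks_zero _ (by positivity) (by positivity) a b

lemma vicNum_zero {i j : ℕ} (hi : 0 < i) (hj : 0 < j) (a b : ℤ) :
    vicNum i j 0 a b = if a = i ∧ b = j then 1 else 0 :=
  card_gapWalks_zero _ (by positivity) (by positivity) a b

lemma oscNum_eq_zero {i j n : ℕ} {a b : ℤ} (h : a < 0 ∨ b < 0) : oscNum i j n a b = 0 := by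
  have : IsEmpty (GapWalks (0 ≤ ·) (fun u v => u = 0 → 0 < v) i j n a b) := by
    refine ⟨?_⟩
    rintro ⟨p, -, h2, -, -, h3, h4⟩
    have := h2 (Fin.last n)
    omega
  exact Nat.card_of_isEmpty

lemma vicNum_eq_zero {i j n : ℕ} {a b : ℤ} (h : a ≤ 0 ∨ b ≤ 0) : vicNum i j n a b = 0 := by
  have : IsEmpty (GapWalks (0 < ·) (fun _ _ => True) i j n a b) := by
    refine ⟨?_⟩
    rintro ⟨p, -, h2, -, -, h3, h4⟩
    have := h2 (Fin.last n)
    omega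
  exact Nat.card_of_isEmpty

lemma sum_steps (f : ℤ → ℤ → ℕ) :
    ∑ s : Fin 3 → Bool, f (gapStep (s 0) (s 1)) (gapStep (s 1) (s 2)) =
      2 * f 0 0 + f 1 0 + f (-1) 0 + f 0 1 + f 0 (-1) + f 1 (-1) + f (-1) 1 := by
  let e : Bool × Bool × Bool ≃ (Fin 3 → Bool) :=
    { toFun := fun q => ![q.1, q.2.1, q.2.2]
      invFun := fun s => (s 0, s 1, s 2)
      left_inv := fun _ => rfl
      right_inv := fun s => by ext k; fin_cases k <;> rfl }
  have he (q : Bool × Bool × Bool) : e q = ![q.1, q.2.1, q.2.2] := rfl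
  rw [← e.sum_comp]
  simp [Fintype.sum_prod_type, he, gapStep]
  ring

lemma vicNum_succ {i j n : ℕ} {a b : ℤ} (ha : 0 < a) (hb : 0 < b) :
    vicNum i j (n + 1) a b = 2 * vicNum i j n a b + vicNum i j n (a - 1) b +
      vicNum i j n (a + 1) b + vicNum i j n a (b - 1) + vicNum i j n a (b + 1) +
      vicNum i j n (a - 1) (b + 1) + vicNum i j n (a + 1) (b - 1) := by
  refine (card_gapWalks_succ ..).trans ((sum_steps fun u v =>
    if 0 < 2 * a ∧ 0 < 2 * b ∧ True ∧ True then
    Nat.card (GapWalks (0 < ·) (fun _ _ => True) i j n (a - u) (b - v)) else 0).trans ?_)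
  simp [ha, hb, vicNum]

lemma oscNum_succ {i j n : ℕ} {a b : ℤ} (ha : 0 ≤ a) (hb : 0 ≤ b) :
    oscNum i j (n + 1) a b =
      (if 0 < a ∧ 0 < b then 2 * oscNum i j n a b else 0) +
      (if 0 < b then oscNum i j n (a - 1) b + oscNum i j n (a + 1) b else 0) +
      (if 0 < a then oscNum i j n a (b - 1) + oscNum i j n a (b + 1) else 0) +
      oscNum i j n (a - 1) (b + 1) + oscNum i j n (a + 1) (b - 1) := by
  refine (card_gapWalks_succ ..).trans ((sum_steps fun u v =>
    if 0 ≤ 2 * a ∧ 0 ≤ 2 * b ∧ (2 * (a - u) = 0 → 0 < 2 * a) ∧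
      (2 * (b - v) = 0 → 0 < 2 * b) then
    Nat.card (GapWalks (0 ≤ ·) (fun u v => u = 0 → 0 < v) i j n (a - u) (b - v)) else 0).trans ?_)
  have e : ∀ u v, Nat.card (GapWalks (0 ≤ ·) (fun u v => u = 0 → 0 < v) i j n u v) =
    oscNum i j n u v := fun u v => rfl
  have h1 (v : ℤ) : oscNum i j n (-1) v = 0 := oscNum_eq_zero (by omega)
  have h2 (v : ℤ) : oscNum i j n v (-1) = 0 := oscNum_eq_zero (by omega)
  simp only [e]
  rcases ha.eq_or_lt with rfl | ha' <;> rcases hb.eq_or_lt with rfl | hb'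
  · simp [h1, h2]
  · simp [h1, hb', hb]
  · simp [h2, ha', ha]
  · simp [ha, hb, ha', hb']
    ring

/-- The coefficientwise form of the relation. -/
lemma oscNum_succ_add (n : ℕ) (a b : ℤ) :
    oscNum 0 1 (n + 1) a b + oscNum 0 1 n a b =
      vicNum 1 1 n (a + 1) b + vicNum 1 1 n a (b + 1) + vicNum 1 1 n a b := by
  by_cases hab : 0 ≤ a ∧ 0 ≤ b
  swap
  · rw [oscNum_eq_zero (by omega), oscNum_eq_zero (by omega), vicNum_eq_zero (by omega),
      vicNum_eq_zero (by omega), vicNum_eq_zero (by omega)]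
  obtain ⟨ha, hb⟩ := hab
  induction n generalizing a b with
  | zero =>
    rw [oscNum_succ ha hb]
    simp only [oscNum_zero, vicNum_zero Nat.one_pos Nat.one_pos, Nat.cast_zero, Nat.cast_one]
    rcases ha.eq_or_lt with rfl | ha' <;> rcases hb.eq_or_lt with rfl | hb'
    · simp
    · simp [hb']
    · simp [ha']
      grind
    · simp [ha', hb']
      grind
  | succ n ih =>
    have h0 (n : ℕ) (v : ℤ) : vicNum 1 1 n 0 v = 0 := vicNum_eq_zero (by omega)
    have h0' (n : ℕ) (v : ℤ) : vicNum 1 1 n v 0 = 0 := vicNum_eq_zero (by omega)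
    have h1 (n : ℕ) (v : ℤ) : oscNum 0 1 n (-1) v = 0 := oscNum_eq_zero (by omega)
    have h1' (n : ℕ) (v : ℤ) : oscNum 0 1 n v (-1) = 0 := oscNum_eq_zero (by omega)
    refine (congrArg₂ (· + ·) (oscNum_succ ha hb) (oscNum_succ ha hb)).trans ?_
    rcases ha.eq_or_lt with rfl | ha' <;> rcases hb.eq_or_lt with rfl | hb'
    · simp [h0, h0', h1, h1']
    · rw [vicNum_succ (by omega) hb']
      have e1 := ih 1 b (by omega) (by omega)
      have e2 := ih 1 (b - 1) (by omega) (by omega)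
      simp [h0, hb', h1]
      ring_nf at *
      omega
    · rw [vicNum_succ ha' (by omega) (b := 0 + 1)]
      have e1 := ih a 1 (by omega) (by omega)
      have e2 := ih (a - 1) 1 (by omega) (by omega)
      simp [h0', ha', h1']
      ring_nf at *
      omega
    · rw [vicNum_succ ha' hb', vicNum_succ (by omega) hb', vicNum_succ ha' (by omega)]
      have e1 := ih a b (by omega) (by omega)
      have e2 := ih (a - 1) b (by omega) (by omega)
      have e3 := ih (a + 1) b (by omega) (by omega)
      have e4 := ih a (b - 1) (by omega) (by omega)
      have e5 := ih a (b + 1) (by omega) (by omega)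
      have e6 := ih (a - 1) (b + 1) (by omega) (by omega)
      have e7 := ih (a + 1) (b - 1) (by omega) (by omega)
      simp only [ha', hb', and_self, if_true]
      ring_nf at *
      omega

open MvPowerSeries in
/-- Multiplication by a variable shifts coefficients. -/
lemma MvPowerSeries.coeff_X_mul_eq_ite {σ A : Type*} [Semiring A] [DecidableEq σ] (s : σ)
    (φ : MvPowerSeries σ A) (e : σ →₀ ℕ) :
    coeff e (X s * φ) = if e s = 0 then 0 else coeff (e - Finsupp.single s 1) φ := by
  rw [X, coeff_monomial_mul, one_mul]
  simp only [Finsupp.single_le_iff, Nat.one_le_iff_ne_zero, ite_not]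

open MvPowerSeries in
theorem osculating_zero_one_complete_gf_relation :
    (1 + (X 0 : MvPowerSeries (Fin 3) ℚ)) * X 1 * X 2 * Ocgf 0 1 =
      X 1 * X 2 ^ 2 + X 0 * (X 1 + X 2 + X 1 * X 2) * Vcgf 1 1 := by
  have hO (e : Fin 3 →₀ ℕ) : coeff e (Ocgf 0 1) = oscNum 0 1 (e 0) (e 1) (e 2) :=
    congrArg Nat.cast (oscCount_eq ..)
  have hV (e : Fin 3 →₀ ℕ) : coeff e (Vcgf 1 1) = vicNum 1 1 (e 0) (e 1) (e 2) :=
    congrArg Nat.cast (vicCount_eq ..)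
  have hL : (1 + (X 0 : MvPowerSeries (Fin 3) ℚ)) * X 1 * X 2 * Ocgf 0 1 =
      X 1 * (X 2 * Ocgf 0 1) + X 0 * (X 1 * (X 2 * Ocgf 0 1)) := by ring
  have hR : X 1 * X 2 ^ 2 + X 0 * (X 1 + X 2 + X 1 * X 2) * Vcgf 1 1 =
      X 1 * (X 2 * (X 2 * (1 : MvPowerSeries (Fin 3) ℚ))) + X 0 * (X 1 * Vcgf 1 1) +
        X 0 * (X 2 * Vcgf 1 1) + X 0 * (X 1 * (X 2 * Vcgf 1 1)) := by ring
  have h0 (n : ℕ) (v : ℤ) : vicNum 1 1 n 0 v = 0 := vicNum_eq_zero (by omega)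
  have h0' (n : ℕ) (v : ℤ) : vicNum 1 1 n v 0 = 0 := vicNum_eq_zero (by omega)
  have h1 (e : Fin 3 →₀ ℕ) : e = 0 ↔ e 0 = 0 ∧ e 1 = 0 ∧ e 2 = 0 := by
    simp [Finsupp.ext_iff, Fin.forall_fin_succ]
  rw [hL, hR]
  ext e
  simp only [map_add, MvPowerSeries.coeff_X_mul_eq_ite, hO, hV, coeff_one, h1]
  simp
  generalize e 0 = n
  generalize e 1 = k
  generalize e 2 = l
  rcases k with - | k <;> rcases l with - | l <;> rcases n with - | n
  all_goals simp [h0, h0', oscNum_zero]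
  · grind
  · have h := congrArg (Nat.cast (R := ℚ)) (oscNum_succ_add n k l)
    push_cast at h
    linear_combination h
end

section
/- For every n ≥ 0, the number o_{1,0}^{(1,0)}(n) of osculating (1,0)-stars of length n with j_{n,2}−j_{n,1}=2 and j_{n,3}=j_{n,2} equals o_{0,1}^{(1,0)}(n) + (−1)^n, where o_{0,1}^{(1,0)}(n) is the number of osculating (0,1)-stars of length n with j_{n,2}−j_{n,1}=2 and j_{n,3}=j_{n,2}. -/
/-- Osculating configurations with starting ordinates `a`, ending with `p 1 - p 0 = 2` and
`p 2 = p 1`. -/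
def stars (n : ℕ) (a : Fin 3 → ℤ) : Set (Fin 3 → Fin (n + 1) → ℤ) :=
  {p | Osculating p ∧ (∀ k, p k 0 = a k) ∧
    p 1 (Fin.last n) - p 0 (Fin.last n) = 2 ∧ p 2 (Fin.last n) = p 1 (Fin.last n)}

/-- Prepend the ordinates `a` to a configuration. -/
def consStart {n : ℕ} (a : Fin 3 → ℤ) (p : Fin 3 → Fin (n + 1) → ℤ) :
    Fin 3 → Fin (n + 2) → ℤ :=
  fun k => Fin.cons (a k) (p k)

lemma consStart_injective {n : ℕ} (a : Fin 3 → ℤ) :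
    Function.Injective (consStart (n := n) a) := by
  intro p q h
  funext k m
  simpa [consStart] using congrFun (congrFun h k) m.succ

lemma osculating_consStart {n : ℕ} (a : Fin 3 → ℤ) (p : Fin 3 → Fin (n + 1) → ℤ) :
    Osculating (consStart a p) ↔
      (∀ k, p k 0 - a k = 1 ∨ p k 0 - a k = -1) ∧ (a 0 ≤ a 1 ∧ a 1 ≤ a 2) ∧
        ((a 0 = a 1 → p 0 0 < p 1 0) ∧ (a 1 = a 2 → p 1 0 < p 2 0)) ∧ Osculating p := by
  simp only [Osculating, IsSteps, NonCrossing, consStart, Fin.forall_fin_succ (n := n),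
    Fin.forall_fin_succ (n := n + 1), Fin.castSucc_zero, Fin.cons_zero, Fin.cons_succ,
    ← Fin.succ_castSucc, forall_and]
  tauto

lemma consStart_mem_stars {n : ℕ} (a c : Fin 3 → ℤ) (p : Fin 3 → Fin (n + 1) → ℤ) :
    consStart c p ∈ stars (n + 1) a ↔
      c = a ∧ (∀ k, p k 0 - a k = 1 ∨ p k 0 - a k = -1) ∧ (a 0 ≤ a 1 ∧ a 1 ≤ a 2) ∧
        ((a 0 = a 1 → p 0 0 < p 1 0) ∧ (a 1 = a 2 → p 1 0 < p 2 0)) ∧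
        p ∈ stars n (fun k => p k 0) := by
  have hc : (∀ k, consStart c p k 0 = a k) ↔ c = a := by simp [consStart, funext_iff]
  have hl : ∀ k, consStart c p k (Fin.last (n + 1)) = p k (Fin.last n) := fun k => by
    rw [← Fin.succ_last]; simp [consStart]
  simp only [stars, Set.mem_ofPred_eq, hc, hl, osculating_consStart, implies_true, true_and]
  constructor
  · rintro ⟨h, rfl, h'⟩; tauto
  · rintro ⟨rfl, h⟩; tauto

lemma exists_eq_consStart {n : ℕ} (p : Fin 3 → Fin (n + 2) → ℤ) :
    ∃ a q, p = consStart a q :=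
  ⟨fun k => p k 0, fun k => Fin.tail (p k), by funext k; simp [consStart]⟩

lemma mem_stars_start {n : ℕ} {a : Fin 3 → ℤ} {p : Fin 3 → Fin (n + 1) → ℤ} :
    p ∈ stars n a ↔ (fun k => p k 0) = a ∧ p ∈ stars n (fun k => p k 0) := by
  simp only [stars, Set.mem_ofPred_eq, funext_iff, implies_true, true_and]
  tauto

lemma finite_stars (n : ℕ) (a : Fin 3 → ℤ) : (stars n a).Finite := by
  induction n generalizing a with
  | zero =>
    refine Set.Finite.subset (Set.finite_singleton fun k _ => a k) fun p hp => ?_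
    funext k m
    rw [Fin.fin_one_eq_zero m]
    exact hp.2.1 k
  | succ n ih =>
    have hfin : (Set.univ.pi fun k => ({a k + 1, a k - 1} : Set ℤ)).Finite :=
      Set.Finite.pi fun k => by simp
    refine ((hfin.biUnion fun b _ => ih b).image (consStart a)).subset fun p hp => ?_
    obtain ⟨c, q, rfl⟩ := exists_eq_consStart p
    obtain ⟨rfl, hs, -, -, hq⟩ := (consStart_mem_stars _ _ _).1 hp
    refine ⟨q, Set.mem_biUnion (x := fun k => q k 0) ?_ hq, rfl⟩
    intro k _
    simp only [Set.mem_insert_iff, Set.mem_singleton_iff]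
    have := hs k
    omega

lemma ncard_stars_succ_of_forall {n : ℕ} {a b c : Fin 3 → ℤ} (hbc : b ≠ c)
    (h : ∀ d : Fin 3 → ℤ, ((∀ k, d k - a k = 1 ∨ d k - a k = -1) ∧ (a 0 ≤ a 1 ∧ a 1 ≤ a 2) ∧
      (a 0 = a 1 → d 0 < d 1) ∧ (a 1 = a 2 → d 1 < d 2)) ↔ d = b ∨ d = c) :
    (stars (n + 1) a).ncard = (stars n b).ncard + (stars n c).ncard := by
  have hd : Disjoint (stars n b) (stars n c) := by
    refine Set.disjoint_left.2 fun p hp hp' => hbc ?_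
    rw [← (mem_stars_start.1 hp).1, ← (mem_stars_start.1 hp').1]
  rw [← Set.ncard_union_eq hd (finite_stars n b) (finite_stars n c),
    ← Set.ncard_image_of_injective (stars n b ∪ stars n c) (consStart_injective a)]
  refine congrArg Set.ncard ?_
  ext p
  obtain ⟨e, q, rfl⟩ := exists_eq_consStart p
  have hq := h fun k => q k 0
  rw [consStart_mem_stars]
  constructor
  · rintro ⟨rfl, h₁, h₂, h₃, h₄⟩
    refine ⟨q, ?_, rfl⟩
    rw [Set.mem_union, mem_stars_start, mem_stars_start (a := c)]
    have := hq.1 ⟨h₁, h₂, h₃⟩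
    tauto
  · rintro ⟨r, hr, hre⟩
    have he : a = e := by
      funext k
      simpa [consStart] using congrFun (congrFun hre k) 0
    subst he
    obtain rfl := consStart_injective _ hre
    rw [Set.mem_union, mem_stars_start, mem_stars_start (a := c)] at hr
    have := hq.2 (by tauto)
    tauto

lemma ncard_stars_add_const (n : ℕ) (a : Fin 3 → ℤ) (t : ℤ) :
    (stars n fun k => a k + t).ncard = (stars n a).ncard := by
  have hinj : Function.Injective
      (fun (p : Fin 3 → Fin (n + 1) → ℤ) k m => p k m + t) := by
    intro p q h
    funext k m
    simpa using congrFun (congrFun h k) m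
  rw [← Set.ncard_image_of_injective (stars n a) hinj]
  refine congrArg Set.ncard ?_
  ext p
  obtain ⟨q, rfl⟩ : ∃ q : Fin 3 → Fin (n + 1) → ℤ, p = fun k m => q k m + t :=
    ⟨fun k m => p k m - t, by simp⟩
  rw [hinj.mem_set_image]
  simp [stars, Osculating, IsSteps, NonCrossing]

lemma ncard_stars_succ_one_zero (n : ℕ) :
    (stars (n + 1) ![0, 2, 2]).ncard =
      (stars n ![-1, 1, 3]).ncard + (stars n ![0, 0, 2]).ncard := by
  rw [← ncard_stars_add_const n ![0, 0, 2] 1]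
  apply ncard_stars_succ_of_forall
  · intro h
    simpa using congrFun h 0
  · intro d
    simp only [funext_iff, Fin.forall_fin_succ]
    simp
    omega

lemma ncard_stars_succ_zero_one (n : ℕ) :
    (stars (n + 1) ![0, 0, 2]).ncard =
      (stars n ![-1, 1, 3]).ncard + (stars n ![0, 2, 2]).ncard := by
  rw [← ncard_stars_add_const n ![0, 2, 2] (-1)]
  apply ncard_stars_succ_of_forall
  · intro h
    simpa using congrFun h 2
  · intro d
    simp only [funext_iff, Fin.forall_fin_succ]
    simp
    omega

lemma ncard_stars_one_zero_eq (n : ℕ) :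
    ((stars n ![0, 2, 2]).ncard : ℤ) = (stars n ![0, 0, 2]).ncard + (-1) ^ n := by
  induction n with
  | zero =>
    have h₁ : stars 0 ![0, 2, 2] = {fun k _ => ![0, 2, 2] k} := by
      ext p
      rw [Set.mem_singleton_iff]
      simp [stars, Osculating, IsSteps, NonCrossing, funext_iff, Fin.forall_fin_succ]
      omega
    have h₂ : stars 0 ![0, 0, 2] = ∅ := by
      ext p
      simp [stars, Fin.forall_fin_succ]
      omega
    simp [h₁, h₂]
  | succ n ih =>
    rw [ncard_stars_succ_one_zero, ncard_stars_succ_zero_one, pow_succ]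
    push_cast
    linarith

theorem osculating_one_zero_vs_zero_one (n : ℕ) :
    (Nat.card {p : Fin 3 → Fin (n + 1) → ℤ // Osculating p ∧ Starts 1 0 p ∧
        p 1 (Fin.last n) - p 0 (Fin.last n) = 2 ∧
        p 2 (Fin.last n) = p 1 (Fin.last n)} : ℤ) =
      (Nat.card {p : Fin 3 → Fin (n + 1) → ℤ // Osculating p ∧ Starts 0 1 p ∧
        p 1 (Fin.last n) - p 0 (Fin.last n) = 2 ∧
        p 2 (Fin.last n) = p 1 (Fin.last n)} : ℤ) + (-1) ^ n := by
  simpa [stars, Starts, Fin.forall_fin_succ, ← Nat.card_coe_set_eq, Set.coe_ofPred]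
    using ncard_stars_one_zero_eq n
end

section
/- The generating function B(t) = Σ_{n≥1} b_n t^n ∈ ℚ[[t]] of the Baxter numbers satisfies the linear differential equation (with formal derivatives) 12t − 6(1−2t)·B(t) − 2t(3−14t−8t^2)·B'(t) − t^2(1+t)(1−8t)·B''(t) = 0. -/
/-- The `k`-th Baxter number `b_k = (2/(k(k+1)^2)) Σ_{r=0}^{k-1} C(k+1,r)C(k+1,r+1)C(k+1,r+2)`. -/
noncomputable def baxter (k : ℕ) : ℚ :=
  2 / ((k : ℚ) * ((k : ℚ) + 1) ^ 2) *
    ∑ r ∈ Finset.range k,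
      ((k + 1).choose r * (k + 1).choose (r + 1) * (k + 1).choose (r + 2) : ℚ)

/-- The generating function `B(t) = Σ_{n ≥ 1} b_n t^n` of the Baxter numbers. -/
noncomputable def baxterGF : PowerSeries ℚ :=
  PowerSeries.mk fun n => if n = 0 then 0 else baxter n

theorem cast_choose_mul_succ_eq (n k : ℕ) :
    (n.choose k : ℚ) * (n + 1) = (n + 1).choose k * (n + 1 - k) := by
  rcases le_or_gt k (n + 1) with h | h
  · have := congrArg (Nat.cast (R := ℚ)) (Nat.choose_mul_succ_eq n k)
    push_cast [Nat.cast_sub h] at this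
    exact this
  · rw [Nat.choose_eq_zero_of_lt h, Nat.choose_eq_zero_of_lt (by omega)]
    simp

theorem cast_choose_succ_right_eq (n k : ℕ) :
    (n.choose (k + 1) : ℚ) * (k + 1) = n.choose k * (n - k) := by
  rcases le_or_gt k n with h | h
  · have := congrArg (Nat.cast (R := ℚ)) (Nat.choose_succ_right_eq n k)
    push_cast [Nat.cast_sub h] at this
    exact this
  · rw [Nat.choose_eq_zero_of_lt h, Nat.choose_eq_zero_of_lt (by omega)]
    simp

/-- The product of three consecutive binomial coefficients summed in the Baxter numbers. -/
def chooseTriple (n r : ℕ) : ℚ := n.choose r * n.choose (r + 1) * n.choose (r + 2)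

theorem chooseTriple_eq_zero {n r : ℕ} (h : n < r + 2) : chooseTriple n r = 0 := by
  simp [chooseTriple, Nat.choose_eq_zero_of_lt h]

theorem chooseTriple_mul_succ_pow (n r : ℕ) :
    chooseTriple n r * (n + 1) ^ 3 =
      chooseTriple (n + 1) r * ((n + 1 - r) * (n - r) * (n - 1 - r)) := by
  have h₀ := cast_choose_mul_succ_eq n r
  have h₁ := cast_choose_mul_succ_eq n (r + 1)
  have h₂ := cast_choose_mul_succ_eq n (r + 2)
  push_cast at h₁ h₂
  calc chooseTriple n r * (n + 1) ^ 3
      = (n.choose r * (n + 1)) * (n.choose (r + 1) * (n + 1)) *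
          (n.choose (r + 2) * (n + 1)) := by unfold chooseTriple; ring
    _ = _ := by rw [h₀, h₁, h₂]; unfold chooseTriple; ring

theorem chooseTriple_succ_mul (n r : ℕ) :
    chooseTriple n (r + 1) * ((r + 1) * (r + 2) * (r + 3)) =
      chooseTriple n r * ((n - r) * (n - 1 - r) * (n - 2 - r)) := by
  have h₀ := cast_choose_succ_right_eq n r
  have h₁ := cast_choose_succ_right_eq n (r + 1)
  have h₂ := cast_choose_succ_right_eq n (r + 2)
  push_cast at h₁ h₂
  calc chooseTriple n (r + 1) * ((r + 1) * (r + 2) * (r + 3))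
      = (n.choose (r + 1) * (r + 1)) * (n.choose (r + 2) * (r + 1 + 1)) *
          (n.choose (r + 3) * (r + 2 + 1)) := by unfold chooseTriple; ring
    _ = _ := by rw [h₀, h₁, h₂]; unfold chooseTriple; ring

/-- Creative telescoping for the sum of products of three consecutive binomial coefficients. -/
theorem sum_range_chooseTriple (m k : ℕ) :
    (∑ r ∈ Finset.range k,
      ((m + 3) * (m + 4) * (m + 1) * m * chooseTriple (m + 2) r
        - (7 * (m + 1) * (m + 2) - 2) * (m + 2) ^ 2 * chooseTriple (m + 1) r
        - 8 * (m + 1) ^ 2 * (m + 2) ^ 2 * chooseTriple m r)) * ((m + 1) * (m + 2)) =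
      k * (k + 1) * (k + 2) * (4 * k ^ 3 - 18 * (m + 1) * k ^ 2
        + ((m + 1) * (27 * m + 30) - 4) * k - (m + 1) * (14 * m ^ 2 + 33 * m + 12)) *
        chooseTriple (m + 2) k := by
  induction k with
  | zero => simp
  | succ k ih =>
    rw [Finset.sum_range_succ, add_mul, ih]
    have h₁ := chooseTriple_mul_succ_pow (m + 1) k
    have h₀ := chooseTriple_mul_succ_pow m k
    have hs := chooseTriple_succ_mul (m + 2) k
    push_cast at h₁ hs ⊢
    set T : ℚ := chooseTriple (m + 2) k / ((m + 1) ^ 3 * (m + 2) ^ 3) with hT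
    have t₂ : chooseTriple (m + 2) k = T * ((m + 1) ^ 3 * (m + 2) ^ 3) := by
      rw [hT, div_mul_cancel₀ _ (by positivity)]
    have t₁ : chooseTriple (m + 1) k =
        T * ((m + 1) ^ 3 * ((m + 2 - k) * (m + 1 - k) * (m - k))) := by
      apply mul_right_cancel₀ (b := ((m : ℚ) + 2) ^ 3) (by positivity)
      linear_combination h₁ + (m + 2 - k) * (m + 1 - k) * (m - k) * t₂
    have t₀ : chooseTriple m k =
        T * ((m + 2 - k) * (m + 1 - k) * (m - k)) * ((m + 1 - k) * (m - k) * (m - 1 - k)) := by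
      apply mul_right_cancel₀ (b := ((m : ℚ) + 1) ^ 3) (by positivity)
      linear_combination h₀ + (m + 1 - k) * (m - k) * (m - 1 - k) * t₁
    rw [t₂] at hs ⊢
    rw [t₁, t₀]
    linear_combination -(4 * ((k : ℚ) + 1) ^ 3 - 18 * (m + 1) * (k + 1) ^ 2
        + ((m + 1) * (27 * m + 30) - 4) * (k + 1)
        - (m + 1) * (14 * m ^ 2 + 33 * m + 12)) * hs

theorem baxter_zero : baxter 0 = 0 := by simp [baxter]

theorem baxter_one : baxter 1 = 1 := by norm_num [baxter]

theorem baxter_two : baxter 2 = 2 := by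
  norm_num [baxter, Finset.sum_range_succ, Nat.choose]

theorem baxter_eq_sum_chooseTriple {n N : ℕ} (h : n ≤ N) :
    baxter n = 2 / (n * (n + 1) ^ 2) * ∑ r ∈ Finset.range N, chooseTriple (n + 1) r := by
  rw [← Finset.sum_subset (Finset.range_subset_range.2 h)
    fun r _ hr => chooseTriple_eq_zero (by simp at hr; omega)]
  rfl

theorem baxter_recurrence (n : ℕ) :
    ((n : ℚ) + 4) * (n + 5) * baxter (n + 2) =
      (7 * (n + 2) * (n + 3) - 2) * baxter (n + 1) + 8 * n * (n + 1) * baxter n := by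
  rcases n with _ | n
  · norm_num [baxter_zero, baxter_one, baxter_two]
  · have hsum := sum_range_chooseTriple (n + 2) (n + 3)
    rw [chooseTriple_eq_zero (show n + 2 + 2 < n + 3 + 2 by omega), mul_zero,
      mul_eq_zero, or_iff_left (by positivity)] at hsum
    simp only [Finset.sum_sub_distrib, ← Finset.mul_sum] at hsum
    rw [baxter_eq_sum_chooseTriple (show n + 1 + 2 ≤ n + 3 by omega),
      baxter_eq_sum_chooseTriple (show n + 1 + 1 ≤ n + 3 by omega),
      baxter_eq_sum_chooseTriple (show n + 1 ≤ n + 3 by omega)]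
    simp only [add_assoc, Nat.reduceAdd] at hsum ⊢
    push_cast at hsum ⊢
    generalize ∑ r ∈ Finset.range (n + 3), chooseTriple (n + 4) r = S₂ at hsum ⊢
    generalize ∑ r ∈ Finset.range (n + 3), chooseTriple (n + 3) r = S₁ at hsum ⊢
    generalize ∑ r ∈ Finset.range (n + 3), chooseTriple (n + 2) r = S₀ at hsum ⊢
    have h := congrArg (fun x => 2 / (((n : ℚ) + 2) * (n + 3) ^ 2 * (n + 4) ^ 2) * x) hsum
    rw [← sub_eq_zero]
    simp only [mul_zero] at h
    rw [← h]
    ring_nf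
    field_simp
    ring

theorem coeff_baxterGF (n : ℕ) : PowerSeries.coeff n baxterGF = baxter n := by
  rcases n with _ | n <;> simp [baxterGF, baxter_zero]

open PowerSeries in
theorem baxter_gf_ode :
    12 * X - 6 * (1 - 2 * X) * baxterGF
      - 2 * X * (3 - 14 * X - 8 * X ^ 2) * derivativeFun baxterGF
      - X ^ 2 * (1 + X) * (1 - 8 * X) * derivativeFun (derivativeFun baxterGF)
      = (0 : PowerSeries ℚ) := by
  change 12 * X - 6 * (1 - 2 * X) * baxterGF
      - 2 * X * (3 - 14 * X - 8 * X ^ 2) * derivative ℚ baxterGF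
      - X ^ 2 * (1 + X) * (1 - 8 * X) * derivative ℚ (derivative ℚ baxterGF) = 0
  set D := derivative ℚ baxterGF with hD
  set E := derivative ℚ D with hE
  have hcD (n : ℕ) : coeff n D = baxter (n + 1) * (n + 1) := by
    rw [hD, coeff_derivative, coeff_baxterGF]
  have hcE (n : ℕ) : coeff n E = baxter (n + 2) * (n + 2) * (n + 1) := by
    rw [hE, coeff_derivative, hcD]
    push_cast
    ring
  have expand : 12 * X - 6 * (1 - 2 * X) * baxterGF - 2 * X * (3 - 14 * X - 8 * X ^ 2) * D
      - X ^ 2 * (1 + X) * (1 - 8 * X) * E =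
      C (12 : ℚ) * X ^ 1 - C (6 : ℚ) * baxterGF + C (12 : ℚ) * (X ^ 1 * baxterGF)
        - C (6 : ℚ) * (X ^ 1 * D) + C (28 : ℚ) * (X ^ 2 * D) + C (16 : ℚ) * (X ^ 3 * D)
        - X ^ 2 * E + C (7 : ℚ) * (X ^ 3 * E) + C (8 : ℚ) * (X ^ 4 * E) := by
    simp only [map_ofNat]
    ring
  rw [expand]
  ext n
  simp only [map_sub, map_add, coeff_C_mul, coeff_X_pow_mul', coeff_X_pow, coeff_baxterGF,
    hcD, hcE, map_zero]
  rcases n with _ | _ | _ | _ | n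
  · simp [baxter_zero]
  · norm_num [baxter_zero, baxter_one]
  · norm_num [baxter_one, baxter_two]
  · have := baxter_recurrence 1
    norm_num [baxter_one, baxter_two] at this ⊢
    linear_combination -this
  · have := baxter_recurrence (n + 2)
    simp [add_assoc] at this ⊢
    linear_combination -this
end
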